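/- Let H1 (d1×d1) and H2 (d2×d2) be Hermitian matrices, and suppose the smallest eigenvalue m1 of H1 is nondegenerate with unit eigenvector g, and let m2 be the smallest eigenvalue of H2. If ψ : Fin d1 × Fin d2 → ℂ is a unit vector with ⟨ψ, (H1 ⊗ I + I ⊗ H2) ψ⟩ = m1 + m2, then there exists a unit vector χ : Fin d2 → ℂ with H2 χ = m2 χ such that ψ = g ⊗ χ (i.e. ψ(i,k) = g i · χ k). -/

import Mathlib

open Matrix Kronecker
open scoped ComplexOrder

theorem Matrix.sub_smul_one_mulVec {R n : Type*} [CommRing R] [Fintype n] [DecidableEq n]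
    (H : Matrix n n R) (m : R) (v : n → R) :
    (H - m • (1 : Matrix n n R)) *ᵥ v = H *ᵥ v - m • v := by
  rw [sub_mulVec, smul_mulVec, one_mulVec]

/-- A Hermitian matrix all of whose real eigenvalues are at least `m` dominates `m • 1`. -/
theorem Matrix.IsHermitian.posSemidef_sub_smul_one {n : Type*} [Fintype n] [DecidableEq n]
    {H : Matrix n n ℂ} (hH : H.IsHermitian) {m : ℝ}
    (hm : ∀ (μ : ℝ) (v : n → ℂ), v ≠ 0 → H *ᵥ v = (μ : ℂ) • v → m ≤ μ) :
    (H - (m : ℂ) • (1 : Matrix n n ℂ)).PosSemidef := by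
  have hA : (H - (m : ℂ) • (1 : Matrix n n ℂ)).IsHermitian :=
    hH.sub (by simp [Matrix.IsHermitian, conjTranspose_smul])
  rw [hA.posSemidef_iff_eigenvalues_nonneg]
  intro j
  have hj := hA.mulVec_eigenvectorBasis j
  rw [sub_smul_one_mulVec, sub_eq_iff_eq_add] at hj
  have h0 : (hA.eigenvectorBasis j : n → ℂ) ≠ 0 := fun h =>
    hA.eigenvectorBasis.orthonormal.ne_zero j (by ext i; exact congrFun h i)
  have := hm (hA.eigenvalues j + m) _ h0 (by
    rw [hj]; ext i; simp [add_mul])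
  simpa using this

/-- The operator `A ⊗ 1` acts on the first index of a bipartite vector. -/
theorem Matrix.kronecker_one_mulVec_apply {R m n p : Type*} [CommSemiring R] [Fintype n] [Fintype p]
    [DecidableEq p] (A : Matrix m n R) (v : n × p → R) (i : m) (k : p) :
    ((A ⊗ₖ (1 : Matrix p p R)) *ᵥ v) (i, k) = (A *ᵥ fun j => v (j, k)) i := by
  simp [mulVec, dotProduct, Fintype.sum_prod_type, one_apply]

/-- The operator `1 ⊗ B` acts on the second index of a bipartite vector. -/
theorem Matrix.one_kronecker_mulVec_apply {R m n p : Type*} [CommSemiring R] [Fintype n] [Fintype p]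
    [DecidableEq p] (B : Matrix m n R) (v : p × n → R) (i : p) (k : m) :
    (((1 : Matrix p p R) ⊗ₖ B) *ᵥ v) (i, k) = (B *ᵥ fun l => v (i, l)) k := by
  simp [mulVec, dotProduct, Fintype.sum_prod_type_right, one_apply]

/-- If the expectation of a sum of two positive semidefinite matrices vanishes in `v`,
then both matrices annihilate `v`. -/
theorem Matrix.PosSemidef.mulVec_eq_zero_of_add {n : Type*} [Fintype n] {P Q : Matrix n n ℂ}
    (hP : P.PosSemidef) (hQ : Q.PosSemidef) {v : n → ℂ} (h : star v ⬝ᵥ ((P + Q) *ᵥ v) = 0) :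
    P *ᵥ v = 0 ∧ Q *ᵥ v = 0 := by
  rw [add_mulVec, dotProduct_add,
    add_eq_zero_iff_of_nonneg (hP.dotProduct_mulVec_nonneg v) (hQ.dotProduct_mulVec_nonneg v)] at h
  exact ⟨(hP.dotProduct_mulVec_zero_iff v).1 h.1, (hQ.dotProduct_mulVec_zero_iff v).1 h.2⟩

/-- if the smallest eigenvalue `m1` of `H1` is nondegenerate with
unit eigenvector `g`, and `m2` is the smallest eigenvalue of `H2`, then every
unit vector `ψ` whose energy under `H1 ⊗ I + I ⊗ H2` equals the ground energy
`m1 + m2` is a product vector `g ⊗ χ`, with `χ` a unit ground eigenvector of `H2`. -/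
theorem stmt_15 (d1 d2 : ℕ)
    (H1 : Matrix (Fin d1) (Fin d1) ℂ) (H2 : Matrix (Fin d2) (Fin d2) ℂ)
    (hH1 : H1.IsHermitian) (hH2 : H2.IsHermitian)
    (m1 m2 : ℝ) (g : Fin d1 → ℂ)
    (hg_unit : ∑ i, ‖g i‖ ^ 2 = 1)
    (hg_eig : H1.mulVec g = (m1 : ℂ) • g)
    (hm1_least : ∀ (μ : ℝ) (v : Fin d1 → ℂ), v ≠ 0 → H1.mulVec v = (μ : ℂ) • v → m1 ≤ μ)
    (hm1_nondeg : ∀ v : Fin d1 → ℂ, H1.mulVec v = (m1 : ℂ) • v → ∃ c : ℂ, v = c • g)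
    (hm2_eig : ∃ w : Fin d2 → ℂ, w ≠ 0 ∧ H2.mulVec w = (m2 : ℂ) • w)
    (hm2_least : ∀ (μ : ℝ) (w : Fin d2 → ℂ), w ≠ 0 → H2.mulVec w = (μ : ℂ) • w → m2 ≤ μ)
    (ψ : Fin d1 × Fin d2 → ℂ) (hψ_unit : ∑ x, ‖ψ x‖ ^ 2 = 1)
    (hψ_energy : star ψ ⬝ᵥ ((H1 ⊗ₖ (1 : Matrix (Fin d2) (Fin d2) ℂ)
        + (1 : Matrix (Fin d1) (Fin d1) ℂ) ⊗ₖ H2).mulVec ψ) = ((m1 : ℂ) + (m2 : ℂ))) :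
    ∃ χ : Fin d2 → ℂ, (∑ k, ‖χ k‖ ^ 2 = 1) ∧ H2.mulVec χ = (m2 : ℂ) • χ ∧
      ∀ i k, ψ (i, k) = g i * χ k := by
  have hA := hH1.posSemidef_sub_smul_one hm1_least
  have hB := hH2.posSemidef_sub_smul_one hm2_least
  have hnorm : star ψ ⬝ᵥ ψ = 1 := by
    have : star ψ ⬝ᵥ ψ = ((∑ x, ‖ψ x‖ ^ 2 : ℝ) : ℂ) := by
      simp [dotProduct, Complex.conj_mul']
    rw [this, hψ_unit, Complex.ofReal_one]
  have hsum : (H1 - (m1 : ℂ) • (1 : Matrix (Fin d1) (Fin d1) ℂ)) ⊗ₖ (1 : Matrix (Fin d2) (Fin d2) ℂ)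
      + (1 : Matrix (Fin d1) (Fin d1) ℂ) ⊗ₖ (H2 - (m2 : ℂ) • (1 : Matrix (Fin d2) (Fin d2) ℂ))
      = (H1 ⊗ₖ (1 : Matrix (Fin d2) (Fin d2) ℂ) + (1 : Matrix (Fin d1) (Fin d1) ℂ) ⊗ₖ H2)
        - ((m1 : ℂ) + m2) • (1 : Matrix (Fin d1 × Fin d2) (Fin d1 × Fin d2) ℂ) := by
    rw [← one_kronecker_one]
    ext ⟨i, k⟩ ⟨j, l⟩
    simp only [Matrix.add_apply, Matrix.sub_apply, Matrix.smul_apply, kroneckerMap_apply,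
      smul_eq_mul]
    ring
  obtain ⟨h1, h2⟩ := (hA.kronecker PosSemidef.one).mulVec_eq_zero_of_add
    (PosSemidef.one.kronecker hB) (v := ψ) (by
      rw [hsum, sub_smul_one_mulVec, dotProduct_sub, hψ_energy, dotProduct_smul, hnorm,
        smul_eq_mul, mul_one, sub_self])
  have hcol : ∀ k, ∃ c : ℂ, (fun i => ψ (i, k)) = c • g := fun k => hm1_nondeg _ <| by
    rw [← sub_eq_zero, ← sub_smul_one_mulVec]
    ext i
    rw [← kronecker_one_mulVec_apply, h1]
    rfl
  have hrow : ∀ i, H2 *ᵥ (fun k => ψ (i, k)) = (m2 : ℂ) • fun k => ψ (i, k) := fun i => by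
    rw [← sub_eq_zero, ← sub_smul_one_mulVec]
    ext k
    rw [← one_kronecker_mulVec_apply, h2]
    rfl
  choose χ hχ using hcol
  have hprod : ∀ i k, ψ (i, k) = g i * χ k := fun i k => by
    simpa [mul_comm] using congrFun (hχ k) i
  refine ⟨χ, ?_, ?_, hprod⟩
  · simpa [Fintype.sum_prod_type, hprod, mul_pow, ← Finset.mul_sum, ← Finset.sum_mul, hg_unit]
      using hψ_unit
  · obtain ⟨i, hi⟩ : ∃ i, g i ≠ 0 := by
      by_contra! h
      simp [h] at hg_unit
    have hψi : (fun k => ψ (i, k)) = g i • χ := funext (hprod i)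
    have := hrow i
    rw [hψi, mulVec_smul, smul_comm] at this
    exact smul_right_injective _ hi this
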